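/- Let ρ be a CJ channel operator from A to k outputs B_1,…,B_k (indexed by (Π i, β i) × a). Suppose that for every i, the quantum conditional mutual information I(B_i : B̄_i | A), evaluated on ρ̂ := (1 / card a) · ρ with the index type grouped as systems (β i, Π_{j≠i} β j, a), equals 0. Then ρ = ↑ρ_{B_1|A} · ↑ρ_{B_2|A} ⋯ ↑ρ_{B_k|A} and the extended marginals pairwise commute: [↑ρ_{B_i|A}, ↑ρ_{B_j|A}] = 0 for all i, j. (Theorem 4, implication from condition 3 to condition 2.) -/

import Mathlib

open Matrix BigOperators
open scoped ComplexOrder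

noncomputable section

/-- Partial trace over the first tensor factor. -/
def ptrace₁ {α β : Type*} [Fintype α] (M : Matrix (α × β) (α × β) ℂ) : Matrix β β ℂ :=
  Matrix.of fun j j' => ∑ i, M (i, j) (i, j')

/-- Partial trace over the second tensor factor. -/
def ptrace₂ {α β : Type*} [Fintype β] (M : Matrix (α × β) (α × β) ℂ) : Matrix α α ℂ :=
  Matrix.of fun i i' => ∑ j, M (i, j) (i', j)

/-- `M` is a Choi–Jamiołkowski channel operator from `a` to `b`: positive semidefinite with
partial trace over the output equal to the identity. -/
def IsCJChannel {b a : Type*} [Fintype b] [Fintype a] [DecidableEq a]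
    (M : Matrix (b × a) (b × a) ℂ) : Prop :=
  M.PosSemidef ∧ ptrace₁ M = 1

/-- The marginal `ρ_{B|A}` of a channel operator `ρ_{BC|A}` (partial trace over `C`). -/
def margB {b c a : Type*} [Fintype c] (ρ : Matrix ((b × c) × a) ((b × c) × a) ℂ) :
    Matrix (b × a) (b × a) ℂ :=
  Matrix.of fun p q => ∑ γ, ρ ((p.1, γ), p.2) ((q.1, γ), q.2)

/-- The marginal `ρ_{C|A}` of a channel operator `ρ_{BC|A}` (partial trace over `B`). -/
def margC {b c a : Type*} [Fintype b] (ρ : Matrix ((b × c) × a) ((b × c) × a) ℂ) :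
    Matrix (c × a) (c × a) ℂ :=
  Matrix.of fun p q => ∑ β, ρ ((β, p.1), p.2) ((β, q.1), q.2)

/-- Extension `↑ρ_{B|A}` of a marginal to the full space, tensoring with the identity on `C`. -/
def extB {b c a : Type*} [DecidableEq c] (M : Matrix (b × a) (b × a) ℂ) :
    Matrix ((b × c) × a) ((b × c) × a) ℂ :=
  Matrix.of fun p q => M (p.1.1, p.2) (q.1.1, q.2) * (if p.1.2 = q.1.2 then 1 else 0)

/-- Extension `↑ρ_{C|A}` of a marginal to the full space, tensoring with the identity on `B`. -/
def extC {b c a : Type*} [DecidableEq b] (M : Matrix (c × a) (c × a) ℂ) :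
    Matrix ((b × c) × a) ((b × c) × a) ℂ :=
  Matrix.of fun p q => M (p.1.2, p.2) (q.1.2, q.2) * (if p.1.1 = q.1.1 then 1 else 0)

/-- The Choi–Jamiołkowski operator of a (unitary) matrix `U`. -/
def cjOf {y x : Type*} (U : Matrix y x ℂ) : Matrix (y × x) (y × x) ℂ :=
  Matrix.of fun p q => U p.1 p.2 * star (U q.1 q.2)

/-- A (possibly rectangular-typed) matrix is unitary if both `U Uᴴ = 1` and `Uᴴ U = 1`. -/
def IsUnitaryMat {y x : Type*} [Fintype y] [Fintype x] [DecidableEq y] [DecidableEq x]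
    (U : Matrix y x ℂ) : Prop :=
  U * Uᴴ = 1 ∧ Uᴴ * U = 1

/-- von Neumann entropy of a matrix (junk value `0` if not Hermitian);
`Real.log 0 = 0` gives the usual convention `0 log 0 = 0`. -/
def vNEntropy {n : Type*} [Fintype n] (M : Matrix n n ℂ) : ℝ :=
  letI := Classical.decEq n
  if h : M.IsHermitian then -∑ i, h.eigenvalues i * Real.log (h.eigenvalues i) else 0

/-- Quantum conditional mutual information `I(B:C|A)` of a matrix on `(b × c) × a`,
with systems grouped as `B`, `C`, `A`. -/
def qcmiBCA {b c a : Type*} [Fintype b] [Fintype c] [Fintype a]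
    (ρ : Matrix ((b × c) × a) ((b × c) × a) ℂ) : ℝ :=
  vNEntropy (margB ρ) + vNEntropy (margC ρ) - vNEntropy ρ - vNEntropy (ptrace₁ ρ)

/-- Conjugation of `ρ` on its `A` indices by a matrix `V` from `a` to `σa`. -/
def conjOnA {o σa a : Type*} [Fintype a] (ρ : Matrix (o × a) (o × a) ℂ)
    (V : Matrix σa a ℂ) : Matrix (o × σa) (o × σa) ℂ :=
  Matrix.of fun p q => ∑ x : a, ∑ x' : a, V p.2 x * ρ (p.1, x) (q.1, x') * star (V q.2 x')

section
variable {k : ℕ} {β : Fin k → Type*} {a : Type*}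
  [∀ i, Fintype (β i)] [∀ i, DecidableEq (β i)] [∀ i, Nonempty (β i)]
  [Fintype a] [DecidableEq a] [Nonempty a]

/-- Insert the value `x` at coordinate `i` of a family defined away from `i`. -/
def insertAt (i : Fin k) (x : β i) (g : ∀ j : {j : Fin k // j ≠ i}, β j.1) : ∀ j, β j :=
  fun j => if h : j = i then cast (congrArg β h).symm x else g ⟨j, h⟩

/-- The marginal `ρ_{B_i|A}`: partial trace over all output factors `j ≠ i`. -/
def margOut (i : Fin k) (ρ : Matrix ((∀ j, β j) × a) ((∀ j, β j) × a) ℂ) :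
    Matrix (β i × a) (β i × a) ℂ :=
  Matrix.of fun p q => ∑ g : ∀ j : {j : Fin k // j ≠ i}, β j.1,
    ρ (insertAt i p.1 g, p.2) (insertAt i q.1 g, q.2)

/-- The marginal `ρ_{B̄_i|A}`: partial trace over output factor `i`. -/
def margRest (i : Fin k) (ρ : Matrix ((∀ j, β j) × a) ((∀ j, β j) × a) ℂ) :
    Matrix ((∀ j : {j : Fin k // j ≠ i}, β j.1) × a)
      ((∀ j : {j : Fin k // j ≠ i}, β j.1) × a) ℂ :=
  Matrix.of fun p q => ∑ x : β i, ρ (insertAt i x p.1, p.2) (insertAt i x q.1, q.2)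

/-- Extension `↑ρ_{B_i|A}` of a marginal to the full output space, tensoring with the
identity on all output factors `j ≠ i`. -/
def extOut (i : Fin k) (M : Matrix (β i × a) (β i × a) ℂ) :
    Matrix ((∀ j, β j) × a) ((∀ j, β j) × a) ℂ :=
  Matrix.of fun p q => M (p.1 i, p.2) (q.1 i, q.2) *
    ∏ j ∈ Finset.univ.erase i, (if p.1 j = q.1 j then (1 : ℂ) else 0)

/-- Quantum conditional mutual information `I(B_i : B̄_i | A)` of a matrix on
`(Π j, β j) × a`, with systems grouped as `B_i`, `Π_{j ≠ i} B_j`, `A`. -/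
def qcmiOut (i : Fin k) (ρ : Matrix ((∀ j, β j) × a) ((∀ j, β j) × a) ℂ) : ℝ :=
  vNEntropy (margOut i ρ) + vNEntropy (margRest i ρ) - vNEntropy ρ - vNEntropy (ptrace₁ ρ)

theorem norm_trace_mul_le {n : Type*} [Fintype n] (A B : Matrix n n ℂ) :
    ‖(A * B).trace‖ ≤ ((A * Aᴴ).trace.re + (B * Bᴴ).trace.re) / 2 := by
  have frob (M : Matrix n n ℂ) : (M * Mᴴ).trace.re = ∑ i, ∑ j, ‖M i j‖ ^ 2 := by
    simp only [Matrix.trace, Matrix.diag_apply, Matrix.mul_apply, Complex.re_sum,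
      conjTranspose_apply, RCLike.star_def, Complex.mul_conj, Complex.normSq_eq_norm_sq,
      Complex.ofReal_re]
  rw [frob, frob, Finset.sum_comm (f := fun i j => ‖B i j‖ ^ 2), ← Finset.sum_add_distrib,
    Finset.sum_div]
  refine (norm_sum_le _ _).trans (Finset.sum_le_sum fun i _ => ?_)
  rw [← Finset.sum_add_distrib, Finset.sum_div, Matrix.diag_apply, Matrix.mul_apply]
  refine (norm_sum_le _ _).trans (Finset.sum_le_sum fun j _ => ?_)
  rw [norm_mul]
  nlinarith [sq_nonneg (‖A i j‖ - ‖B j i‖)]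

theorem trace_mul_pow_comm {n : Type*} [Fintype n] [DecidableEq n] (A B : Matrix n n ℂ) (p : ℕ) :
    ((A * B) ^ p).trace = ((B * A) ^ p).trace := by
  cases p with
  | zero => simp
  | succ p =>
    have h : SemiconjBy B ((A * B) ^ p) ((B * A) ^ p) :=
      SemiconjBy.pow_right (by simp [SemiconjBy, mul_assoc]) p
    rw [pow_succ', mul_assoc, Matrix.trace_mul_comm, mul_assoc, ← mul_assoc B, h.eq,
      mul_assoc, ← pow_succ]

theorem norm_trace_pow_two_pow_le_aux {n : Type*} [Fintype n] [DecidableEq n] (m : ℕ) :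
    (∀ T : Matrix n n ℂ, ‖(T ^ 2 ^ (m + 1)).trace‖ ≤ ‖((T * Tᴴ) ^ 2 ^ m).trace‖) ∧
    (∀ A B : Matrix n n ℂ, A.IsHermitian → B.IsHermitian →
      ‖((A * B) ^ 2 ^ m).trace‖ ≤ ‖(A ^ 2 ^ m * B ^ 2 ^ m).trace‖) := by
  induction m with
  | zero =>
    refine ⟨fun T => ?_, fun A B _ _ => by simp⟩
    have h := norm_trace_mul_le T T
    rw [add_self_div_two] at h
    simpa [pow_two] using h.trans ((le_abs_self _).trans (Complex.abs_re_le_norm _))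
  | succ m ih =>
    obtain ⟨hC, hD⟩ := ih
    refine ⟨fun T => ?_, fun A B hA hB => ?_⟩
    · have h1 : T ^ 2 ^ (m + 1 + 1) = (T ^ 2) ^ 2 ^ (m + 1) := by rw [← pow_mul, ← pow_succ']
      have h2 : ((T ^ 2 * (T ^ 2)ᴴ) ^ 2 ^ m).trace = (((Tᴴ * T) * (T * Tᴴ)) ^ 2 ^ m).trace := by
        rw [conjTranspose_pow, pow_two, pow_two, mul_assoc T T, trace_mul_pow_comm,
          trace_mul_pow_comm (Tᴴ * T)]
        simp only [mul_assoc]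
      have hp (M : Matrix n n ℂ) : M ^ 2 ^ m * M ^ 2 ^ m = M ^ 2 ^ (m + 1) := by
        rw [← pow_add, ← two_mul, ← pow_succ']
      rw [h1]
      refine (hC _).trans ?_
      rw [h2]
      refine (hD _ _ (isHermitian_conjTranspose_mul_self T)
        (isHermitian_mul_conjTranspose_self T)).trans ((norm_trace_mul_le _ _).trans ?_)
      rw [((isHermitian_conjTranspose_mul_self T).pow _).eq,
        ((isHermitian_mul_conjTranspose_self T).pow _).eq, hp, hp, trace_mul_pow_comm,
        add_self_div_two]
      exact (le_abs_self _).trans (Complex.abs_re_le_norm _)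
    · have h : ((A * B * (A * B)ᴴ) ^ 2 ^ m).trace = ((A ^ 2 * B ^ 2) ^ 2 ^ m).trace := by
        rw [conjTranspose_mul, hA.eq, hB.eq, mul_assoc, trace_mul_pow_comm,
          trace_mul_pow_comm (A ^ 2)]
        simp only [mul_assoc, pow_two]
      refine (hC _).trans ?_
      rw [h]
      refine (hD _ _ (hA.pow 2) (hB.pow 2)).trans (le_of_eq ?_)
      rw [← pow_mul, ← pow_mul, ← pow_succ']

theorem norm_pow_sub_pow_le {𝔸 : Type*} [NormedRing 𝔸] [NormOneClass 𝔸] {U V : 𝔸} {M : ℝ}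
    (hM : 1 ≤ M) (hU : ‖U‖ ≤ M) (hV : ‖V‖ ≤ M) (n : ℕ) :
    ‖U ^ n - V ^ n‖ ≤ n * M ^ n * ‖U - V‖ := by
  induction n with
  | zero => simp
  | succ n ih =>
    have hd := norm_nonneg (U - V)
    have hMn : (0 : ℝ) ≤ M ^ n := by positivity
    calc ‖U ^ (n + 1) - V ^ (n + 1)‖ = ‖U ^ n * (U - V) + (U ^ n - V ^ n) * V‖ := by
          rw [pow_succ, pow_succ]; noncomm_ring
      _ ≤ ‖U ^ n‖ * ‖U - V‖ + ‖U ^ n - V ^ n‖ * ‖V‖ :=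
          (norm_add_le _ _).trans (add_le_add (norm_mul_le _ _) (norm_mul_le _ _))
      _ ≤ M ^ n * ‖U - V‖ + (n * M ^ n * ‖U - V‖) * M := by
          gcongr
          exact (norm_pow_le _ _).trans (pow_le_pow_left₀ (norm_nonneg _) hU n)
      _ ≤ (n + 1 : ℕ) * M ^ (n + 1) * ‖U - V‖ := by
          push_cast
          rw [pow_succ]
          nlinarith [mul_nonneg (mul_nonneg hMn hd) (sub_nonneg.2 hM)]

open Filter Topology Asymptotics in
/-- The Lie product formula. -/
theorem tendsto_exp_mul_exp_pow {𝔸 : Type*} [NormedRing 𝔸] [NormOneClass 𝔸] [NormedAlgebra ℝ 𝔸]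
    [CompleteSpace 𝔸] (A B : 𝔸) :
    Tendsto (fun n : ℕ => (NormedSpace.exp ((n : ℝ)⁻¹ • A) * NormedSpace.exp ((n : ℝ)⁻¹ • B)) ^ n)
      atTop (𝓝 (NormedSpace.exp (A + B))) := by
  let : NormedAlgebra ℚ 𝔸 := NormedAlgebra.restrictScalars ℚ ℝ 𝔸
  set P : ℝ → 𝔸 := fun t => NormedSpace.exp (t • A) * NormedSpace.exp (t • B)
  set Q : ℝ → 𝔸 := fun t => NormedSpace.exp (t • (A + B))
  have hP : HasDerivAt P (A + B) 0 := by
    have h := (hasDerivAt_exp_smul_const A (0 : ℝ)).mul (hasDerivAt_exp_smul_const B (0 : ℝ))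
    simp only [zero_smul, NormedSpace.exp_zero, one_mul, mul_one] at h
    exact h
  have hQ : HasDerivAt Q (A + B) 0 := by
    have h := hasDerivAt_exp_smul_const (A + B) (0 : ℝ)
    simp only [zero_smul, NormedSpace.exp_zero, one_mul] at h
    exact h
  have hP0 : P 0 = 1 := by simp [P]
  have hQ0 : Q 0 = 1 := by simp [Q]
  have bound : ∀ {F : ℝ → 𝔸}, HasDerivAt F (A + B) 0 → F 0 = 1 →
      ∀ᶠ t in 𝓝 (0 : ℝ), ‖F t‖ ≤ 1 + (‖A + B‖ + 1) * |t| := by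
    intro F hF h0
    filter_upwards [(hasDerivAt_iff_isLittleO.1 hF).def one_pos] with t ht
    rw [h0] at ht
    simp only [sub_zero, Real.norm_eq_abs, one_mul] at ht
    calc ‖F t‖ = ‖1 + (t • (A + B) + (F t - 1 - t • (A + B)))‖ := by congr 1; abel
      _ ≤ 1 + (|t| * ‖A + B‖ + |t|) := by
        refine (norm_add_le _ _).trans ?_
        rw [norm_one]
        gcongr
        refine (norm_add_le _ _).trans ?_
        rw [norm_smul, Real.norm_eq_abs]
        gcongr
      _ = _ := by ring
  have hinv : Tendsto (fun n : ℕ => (n : ℝ)⁻¹) atTop (𝓝 0) := tendsto_inv_atTop_nhds_zero_nat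
  have hlit : (fun t => P t - Q t) =o[𝓝 0] (fun t : ℝ => t) := by
    have := (hasDerivAt_iff_isLittleO.1 hP).sub (hasDerivAt_iff_isLittleO.1 hQ)
    refine (this.congr' (Eventually.of_forall fun t => ?_) (Eventually.of_forall fun t => ?_))
    · simp [hP0, hQ0]
    · simp
  have hd : Tendsto (fun n : ℕ => Real.exp (‖A + B‖ + 1) * (n * ‖P (n : ℝ)⁻¹ - Q (n : ℝ)⁻¹‖))
      atTop (𝓝 0) := by
    rw [← mul_zero (Real.exp (‖A + B‖ + 1))]
    refine Tendsto.const_mul _ ?_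
    have := ((hlit.comp_tendsto hinv).norm_left).tendsto_div_nhds_zero
    refine this.congr fun n => ?_
    simp [div_eq_mul_inv, mul_comm]
  refine tendsto_iff_norm_sub_tendsto_zero.2 (squeeze_zero' (Eventually.of_forall fun _ =>
    norm_nonneg _) ?_ hd)
  filter_upwards [hinv.eventually (bound hP hP0), hinv.eventually (bound hQ hQ0),
    eventually_gt_atTop 0] with n h1 h2 hn
  have hn' : (0 : ℝ) < n := Nat.cast_pos.2 hn
  have hQn : NormedSpace.exp (A + B) = Q (n : ℝ)⁻¹ ^ n := by
    rw [← NormedSpace.exp_nsmul, ← Nat.cast_smul_eq_nsmul ℝ, smul_smul,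
      mul_inv_cancel₀ hn'.ne', one_smul]
  rw [hQn]
  have hpow : (1 + (‖A + B‖ + 1) * |(n : ℝ)⁻¹|) ^ n ≤ Real.exp (‖A + B‖ + 1) := by
    calc _ ≤ Real.exp ((‖A + B‖ + 1) * |(n : ℝ)⁻¹|) ^ n := by
          refine pow_le_pow_left₀ (by positivity) ?_ n
          rw [add_comm]
          exact Real.add_one_le_exp _
      _ = _ := by
          rw [← Real.exp_nat_mul, abs_of_pos (by positivity)]
          congr 1
          field_simp
  refine (norm_pow_sub_pow_le (le_add_of_nonneg_right (by positivity)) h1 h2 n).trans ?_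
  rw [mul_comm (n : ℝ), mul_assoc]
  gcongr

open Filter Topology in
/-- A form of the Golden–Thompson inequality. -/
theorem norm_trace_exp_add_le {n : Type*} [Fintype n] [DecidableEq n] {A B : Matrix n n ℂ}
    (hA : A.IsHermitian) (hB : B.IsHermitian) :
    ‖(NormedSpace.exp (A + B)).trace‖ ≤
      ‖((NormedSpace.exp ((2 : ℝ)⁻¹ • A) * NormedSpace.exp ((2 : ℝ)⁻¹ • B)) ^ 2).trace‖ := by
  cases isEmpty_or_nonempty n
  · simp [Matrix.trace]
  let := Matrix.linftyOpNormedRing (n := n) (α := ℂ)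
  let := Matrix.linftyOpNormedAlgebra (n := n) (R := ℝ) (α := ℂ)
  have := Matrix.linfty_opNormOneClass (n := n) (α := ℂ)
  have hsa (C : Matrix n n ℂ) (hC : C.IsHermitian) (r : ℝ) :
      (NormedSpace.exp (r • C)).IsHermitian := by
    refine IsHermitian.exp ?_
    rw [IsHermitian, conjTranspose_smul, hC.eq, star_trivial]
  set a : ℕ → ℝ := fun m => ‖((NormedSpace.exp (((2 ^ m : ℕ) : ℝ)⁻¹ • A) *
    NormedSpace.exp (((2 ^ m : ℕ) : ℝ)⁻¹ • B)) ^ 2 ^ m).trace‖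
  have ha : Antitone a := by
    refine antitone_nat_of_succ_le fun m => ?_
    have hsq (C : Matrix n n ℂ) : NormedSpace.exp (((2 ^ m : ℕ) : ℝ)⁻¹ • C) =
        NormedSpace.exp (((2 ^ (m + 1) : ℕ) : ℝ)⁻¹ • C) ^ 2 := by
      rw [← Matrix.exp_nsmul, ← Nat.cast_smul_eq_nsmul ℝ, smul_smul]
      congr 2
      push_cast
      field_simp
      rw [pow_succ]
    simp only [a]
    rw [hsq A, hsq B]
    set P := NormedSpace.exp (((2 ^ (m + 1) : ℕ) : ℝ)⁻¹ • A)
    set Q := NormedSpace.exp (((2 ^ (m + 1) : ℕ) : ℝ)⁻¹ • B)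
    refine ((norm_trace_pow_two_pow_le_aux m).1 (P * Q)).trans (le_of_eq ?_)
    rw [conjTranspose_mul, (hsa A hA _).eq, (hsa B hB _).eq, mul_assoc, trace_mul_pow_comm,
      trace_mul_pow_comm (P ^ 2)]
    simp only [mul_assoc, pow_two, P, Q]
  have hlim : Tendsto a atTop (𝓝 ‖(NormedSpace.exp (A + B)).trace‖) := by
    have h := (tendsto_exp_mul_exp_pow A B).comp
      (tendsto_pow_atTop_atTop_of_one_lt (r := 2) one_lt_two)
    have hc : Continuous fun M : Matrix n n ℂ => ‖M.trace‖ := by fun_prop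
    exact (hc.tendsto _).comp h
  simpa [a] using ha.le_of_tendsto hlim 1

/-- The matrix `U diag(f) Uᴴ` with real spectrum `f`. -/
def unitaryDiag {n : Type*} [Fintype n] [DecidableEq n] (U : Matrix n n ℂ) (f : n → ℝ) :
    Matrix n n ℂ :=
  U * diagonal (fun i => (f i : ℂ)) * Uᴴ

section unitaryDiag

variable {n : Type*} [Fintype n] [DecidableEq n] {U V W : Matrix n n ℂ}

theorem isHermitian_unitaryDiag (U : Matrix n n ℂ) (f : n → ℝ) :
    (unitaryDiag U f).IsHermitian := by
  have h : (diagonal fun i => (f i : ℂ))ᴴ = diagonal fun i => (f i : ℂ) := by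
    rw [diagonal_conjTranspose]
    congr 1
    ext i
    simp
  rw [IsHermitian, unitaryDiag, conjTranspose_mul, conjTranspose_mul, conjTranspose_conjTranspose,
    h, mul_assoc]

theorem posSemidef_unitaryDiag (U : Matrix n n ℂ) {f : n → ℝ} (hf : ∀ i, 0 ≤ f i) :
    (unitaryDiag U f).PosSemidef :=
  (PosSemidef.diagonal fun i => by simpa using hf i).mul_mul_conjTranspose_same U

theorem unitaryDiag_mul (hU : Uᴴ * U = 1) (f g : n → ℝ) :
    unitaryDiag U f * unitaryDiag U g = unitaryDiag U (fun i => f i * g i) := by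
  have h : unitaryDiag U f * unitaryDiag U g = U * diagonal (fun i => (f i : ℂ)) * (Uᴴ * U) *
      diagonal (fun i => (g i : ℂ)) * Uᴴ := by
    simp only [unitaryDiag, mul_assoc]
  rw [h, hU, mul_one, mul_assoc U, diagonal_mul_diagonal, unitaryDiag]
  simp

theorem unitaryDiag_smul (r : ℝ) (U : Matrix n n ℂ) (f : n → ℝ) :
    r • unitaryDiag U f = unitaryDiag U (fun i => r * f i) := by
  have h : (diagonal fun i => ((r * f i : ℝ) : ℂ)) = r • diagonal (fun i => (f i : ℂ)) := by
    rw [← diagonal_smul]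
    congr 1
    ext i
    simp
  rw [unitaryDiag, unitaryDiag, h, Matrix.mul_smul, Matrix.smul_mul]

theorem trace_unitaryDiag (hU : Uᴴ * U = 1) (f : n → ℝ) :
    (unitaryDiag U f).trace = ((∑ i, f i : ℝ) : ℂ) := by
  rw [unitaryDiag, Matrix.trace_mul_comm, ← mul_assoc, hU, one_mul, trace_diagonal]
  simp

theorem exp_unitaryDiag (hU : Uᴴ * U = 1) (f : n → ℝ) :
    NormedSpace.exp (unitaryDiag U f) = unitaryDiag U (fun i => Real.exp (f i)) := by
  have hU' : U⁻¹ = Uᴴ := inv_eq_left_inv hU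
  have hu : IsUnit U := (isUnit_iff_exists_inv').2 ⟨_, hU⟩
  rw [unitaryDiag, ← hU', exp_conj _ _ hu, exp_diagonal, unitaryDiag, hU']
  congr 3
  ext i
  rw [Pi.coe_exp, ← Complex.exp_eq_exp_ℂ, Complex.ofReal_exp]

theorem exists_unitaryDiag_of_isHermitian {M : Matrix n n ℂ} (hM : M.IsHermitian) :
    ∃ U : Matrix n n ℂ, Uᴴ * U = 1 ∧ M = unitaryDiag U hM.eigenvalues := by
  refine ⟨hM.eigenvectorUnitary, ?_, ?_⟩
  · exact Unitary.coe_star_mul_self hM.eigenvectorUnitary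
  · conv_lhs => rw [hM.spectral_theorem, Unitary.conjStarAlgAut_apply]
    rfl

theorem exists_unitaryDiag_of_posSemidef {M : Matrix n n ℂ} (hM : M.PosSemidef) :
    ∃ (U : Matrix n n ℂ) (f : n → ℝ), Uᴴ * U = 1 ∧ (∀ i, 0 ≤ f i) ∧ M = unitaryDiag U f := by
  obtain ⟨U, hU, h⟩ := exists_unitaryDiag_of_isHermitian hM.isHermitian
  exact ⟨U, _, hU, hM.eigenvalues_nonneg, h⟩

theorem vNEntropy_unitaryDiag (hU : Uᴴ * U = 1) (f : n → ℝ) :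
    vNEntropy (unitaryDiag U f) = -∑ i, f i * Real.log (f i) := by
  have hH := isHermitian_unitaryDiag U f
  have hroots : Multiset.map f Finset.univ.val = Multiset.map hH.eigenvalues Finset.univ.val := by
    have h := hH.roots_charpoly_eq_eigenvalues
    have hc : (unitaryDiag U f).charpoly = ∏ i, (Polynomial.X - Polynomial.C (f i : ℂ)) := by
      rw [unitaryDiag, charpoly_mul_comm, ← mul_assoc, hU, one_mul, charpoly_diagonal]
    rw [hc, Polynomial.roots_prod _ _ (Finset.prod_ne_zero_iff.2 fun i _ =>
      Polynomial.X_sub_C_ne_zero _)] at h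
    simp only [Polynomial.roots_X_sub_C, Multiset.bind_singleton] at h
    refine Multiset.map_injective Complex.ofReal_injective ?_
    simpa [Multiset.map_map, Function.comp_def] using h
  have hsum := congrArg (fun s => (s.map fun x => x * Real.log x).sum) hroots
  simp only [Multiset.map_map, Function.comp_def] at hsum
  have hdec : Classical.decEq n = ‹DecidableEq n› := Subsingleton.elim _ _
  rw [vNEntropy, hdec, dif_pos hH]
  exact congrArg Neg.neg hsum.symm

theorem trace_unitaryDiag_mul (U V : Matrix n n ℂ) (f g : n → ℝ) :
    (unitaryDiag U f * unitaryDiag V g).trace.re =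
      ∑ i, ∑ j, f i * g j * ‖(Uᴴ * V) i j‖ ^ 2 := by
  have h : (unitaryDiag U f * unitaryDiag V g).trace =
      (diagonal (fun i => (f i : ℂ)) * (Uᴴ * V) * (diagonal (fun i => (g i : ℂ)) *
        (Uᴴ * V)ᴴ)).trace := by
    rw [conjTranspose_mul, conjTranspose_conjTranspose, unitaryDiag, unitaryDiag, mul_assoc,
      mul_assoc U, Matrix.trace_mul_comm]
    simp only [mul_assoc]
  rw [h, Matrix.trace, Complex.re_sum]
  refine Finset.sum_congr rfl fun i _ => ?_
  rw [diag_apply, mul_apply, Complex.re_sum]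
  refine Finset.sum_congr rfl fun j _ => ?_
  rw [diagonal_mul, diagonal_mul, conjTranspose_apply, RCLike.star_def]
  have h2 : (f i : ℂ) * (Uᴴ * V) i j * (g j * (starRingEnd ℂ) ((Uᴴ * V) i j)) =
      ((f i * g j * ‖(Uᴴ * V) i j‖ ^ 2 : ℝ) : ℂ) := by
    push_cast
    rw [← Complex.mul_conj']
    ring
  rw [h2, Complex.ofReal_re]

theorem sum_norm_sq_row (hU : Uᴴ * U = 1) (i : n) : ∑ j, ‖U i j‖ ^ 2 = 1 := by
  have hU' : U * Uᴴ = 1 := mul_eq_one_comm.1 hU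
  have h := congrFun (congrFun hU' i) i
  rw [mul_apply, one_apply_eq] at h
  simp only [conjTranspose_apply, RCLike.star_def, Complex.mul_conj'] at h
  exact_mod_cast h

theorem sum_norm_sq_col (hU : Uᴴ * U = 1) (j : n) : ∑ i, ‖U i j‖ ^ 2 = 1 := by
  have h := sum_norm_sq_row (U := Uᴴ) (by
    rw [conjTranspose_conjTranspose]; exact mul_eq_one_comm.1 hU) j
  simpa using h

theorem unitary_conjTranspose_mul (hU : Uᴴ * U = 1) (hV : Vᴴ * V = 1) :
    (Uᴴ * V)ᴴ * (Uᴴ * V) = 1 := by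
  rw [conjTranspose_mul, conjTranspose_conjTranspose, mul_assoc, ← mul_assoc U,
    mul_eq_one_comm.1 hU, one_mul, hV]

/-- A strengthened Klein inequality. -/
theorem trace_mul_add_vNEntropy_le (hW : Wᴴ * W = 1) (hU : Uᴴ * U = 1) {r : n → ℝ}
    (hr : ∀ i, 0 ≤ r i) (h : n → ℝ) :
    (unitaryDiag W r * unitaryDiag U h).trace.re + vNEntropy (unitaryDiag W r) ≤
      2 * (unitaryDiag W (fun i => √(r i)) * unitaryDiag U (fun i => Real.exp (h i / 2))).trace.re
        - 2 * (unitaryDiag W r).trace.re := by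
  have hWU := unitary_conjTranspose_mul hW hU
  have key (x y : ℝ) (hx : 0 ≤ x) :
      x * y - x * Real.log x ≤ 2 * (√x * Real.exp (y / 2)) - 2 * x := by
    rcases hx.eq_or_lt with rfl | hx
    · simp
    have hs := Real.sqrt_pos.2 hx
    have h1 := Real.log_le_sub_one_of_pos (div_pos (Real.exp_pos (y / 2)) hs)
    rw [Real.log_div (Real.exp_pos _).ne' hs.ne', Real.log_exp, Real.log_sqrt hx.le] at h1
    have h2 : x * (Real.exp (y / 2) / √x) = √x * Real.exp (y / 2) := by
      nth_rewrite 1 [← Real.mul_self_sqrt hx.le]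
      field_simp
    nlinarith [mul_le_mul_of_nonneg_left h1 hx.le]
  have hrow (g : n → ℝ) : ∑ i, g i = ∑ i, ∑ j, g i * ‖(Wᴴ * U) i j‖ ^ 2 := by
    refine Finset.sum_congr rfl fun i _ => ?_
    rw [← Finset.mul_sum, sum_norm_sq_row hWU, mul_one]
  rw [vNEntropy_unitaryDiag hW, trace_unitaryDiag hW, Complex.ofReal_re, trace_unitaryDiag_mul,
    trace_unitaryDiag_mul, hrow r, hrow fun i => r i * Real.log (r i), ← sub_eq_add_neg,
    ← Finset.sum_sub_distrib, Finset.mul_sum, Finset.mul_sum, ← Finset.sum_sub_distrib]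
  refine Finset.sum_le_sum fun i _ => ?_
  rw [← Finset.sum_sub_distrib, Finset.mul_sum, Finset.mul_sum, ← Finset.sum_sub_distrib]
  refine Finset.sum_le_sum fun j _ => ?_
  nlinarith [mul_le_mul_of_nonneg_right (key (r i) (h j) (hr i)) (sq_nonneg ‖(Wᴴ * U) i j‖)]

/-- Klein's inequality. -/
theorem trace_mul_add_vNEntropy_le_exp {ρ H : Matrix n n ℂ} (hρ : ρ.PosSemidef)
    (hH : H.IsHermitian) :
    (ρ * H).trace.re + vNEntropy ρ ≤ (NormedSpace.exp H).trace.re - ρ.trace.re := by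
  obtain ⟨W, r, hW, hr, rfl⟩ := exists_unitaryDiag_of_posSemidef hρ
  obtain ⟨U, hU, h⟩ := exists_unitaryDiag_of_isHermitian hH
  rw [h]
  set f := hH.eigenvalues
  have hWU := unitary_conjTranspose_mul hW hU
  refine (trace_mul_add_vNEntropy_le hW hU hr f).trans ?_
  rw [exp_unitaryDiag hU, trace_unitaryDiag hW, trace_unitaryDiag hU, trace_unitaryDiag_mul,
    Complex.ofReal_re, Complex.ofReal_re]
  have hrow : ∑ i, r i = ∑ i, ∑ j, r i * ‖(Wᴴ * U) i j‖ ^ 2 := by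
    refine Finset.sum_congr rfl fun i _ => ?_
    rw [← Finset.mul_sum, sum_norm_sq_row hWU, mul_one]
  have hcol : ∑ j, Real.exp (f j) = ∑ i, ∑ j, Real.exp (f j) * ‖(Wᴴ * U) i j‖ ^ 2 := by
    rw [Finset.sum_comm]
    refine Finset.sum_congr rfl fun i _ => ?_
    rw [← Finset.mul_sum, sum_norm_sq_col hWU, mul_one]
  have hle : 2 * ∑ i, ∑ j, √(r i) * Real.exp (f j / 2) * ‖(Wᴴ * U) i j‖ ^ 2 ≤
      ∑ j, Real.exp (f j) + ∑ i, r i := by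
    rw [hcol, hrow, ← Finset.sum_add_distrib, Finset.mul_sum]
    refine Finset.sum_le_sum fun i _ => ?_
    rw [← Finset.sum_add_distrib, Finset.mul_sum]
    refine Finset.sum_le_sum fun j _ => ?_
    have h1 : Real.exp (f j) = Real.exp (f j / 2) ^ 2 := by
      rw [← Real.exp_nat_mul]; congr 1; push_cast; ring
    have h2 := Real.sq_sqrt (hr i)
    rw [h1]
    nlinarith [mul_nonneg (sq_nonneg (√(r i) - Real.exp (f j / 2))) (sq_nonneg ‖(Wᴴ * U) i j‖)]
  linarith

theorem commute_unitaryDiag_comp (hU : Uᴴ * U = 1) {f : n → ℝ} {Z : Matrix n n ℂ}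
    (h : Commute (unitaryDiag U f) Z) (g : ℝ → ℝ) :
    Commute (unitaryDiag U (fun i => g (f i))) Z := by
  have hU' := mul_eq_one_comm.1 hU
  have conj (f : n → ℝ) : Commute (unitaryDiag U f) Z ↔
      Commute (diagonal fun i => (f i : ℂ)) (Uᴴ * Z * U) := by
    constructor <;> intro h
    · have h1 := congrArg (fun M => Uᴴ * M * U) h.eq
      have e1 : Uᴴ * (unitaryDiag U f * Z) * U =
          (Uᴴ * U) * diagonal (fun i => (f i : ℂ)) * (Uᴴ * Z * U) := by
        simp only [unitaryDiag, mul_assoc]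
      have e2 : Uᴴ * (Z * unitaryDiag U f) * U =
          (Uᴴ * Z * U) * diagonal (fun i => (f i : ℂ)) * (Uᴴ * U) := by
        simp only [unitaryDiag, mul_assoc]
      simp only [e1, e2, hU, one_mul, mul_one] at h1
      exact h1
    · have h1 := congrArg (fun M => U * M * Uᴴ) h.eq
      have e1 : U * (diagonal (fun i => (f i : ℂ)) * (Uᴴ * Z * U)) * Uᴴ =
          unitaryDiag U f * Z * (U * Uᴴ) := by
        simp only [unitaryDiag, mul_assoc]
      have e2 : U * ((Uᴴ * Z * U) * diagonal (fun i => (f i : ℂ))) * Uᴴ =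
          (U * Uᴴ) * Z * unitaryDiag U f := by
        simp only [unitaryDiag, mul_assoc]
      simp only [e1, e2, hU', one_mul, mul_one] at h1
      exact h1
  rw [conj] at h ⊢
  ext i j
  have hij := congrFun (congrFun h.eq i) j
  rw [diagonal_mul, mul_diagonal] at hij ⊢
  by_cases hf : f i = f j
  · rw [hf, mul_comm]
  · have : (Uᴴ * Z * U) i j = 0 := by
      have h0 : ((f i : ℂ) - f j) * (Uᴴ * Z * U) i j = 0 := by
        rw [sub_mul, hij]; ring
      exact (mul_eq_zero.1 h0).resolve_left (sub_ne_zero.2 (by exact_mod_cast hf))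
    simp [this]

theorem continuous_unitaryDiag {X : Type*} [TopologicalSpace X] (U : Matrix n n ℂ) {f : X → n → ℝ}
    (hf : Continuous f) : Continuous fun t => unitaryDiag U (f t) := by
  unfold unitaryDiag
  have : Continuous fun t => diagonal fun i => (f t i : ℂ) :=
    Continuous.matrix_diagonal (by fun_prop)
  fun_prop

end unitaryDiag

theorem trace_mul_nonneg_of_posSemidef {n : Type*} [Fintype n] [DecidableEq n] {A B : Matrix n n ℂ}
    (hA : A.PosSemidef) (hB : B.PosSemidef) : 0 ≤ (A * B).trace := by
  obtain ⟨U, f, hU, hf, rfl⟩ := exists_unitaryDiag_of_posSemidef hB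
  have hsq : unitaryDiag U f =
      unitaryDiag U (fun i => √(f i)) * (unitaryDiag U (fun i => √(f i)))ᴴ := by
    rw [(isHermitian_unitaryDiag _ _).eq, unitaryDiag_mul hU]
    simp only [Real.mul_self_sqrt (hf _)]
  have h := hA.conjTranspose_mul_mul_same (unitaryDiag U (fun i => √(f i)))
  rw [hsq, ← mul_assoc, Matrix.trace_mul_comm, ← mul_assoc]
  exact h.trace_nonneg

theorem eq_of_trace_sub_mul_conjTranspose_nonpos {n : Type*} [Fintype n] {A B : Matrix n n ℂ}
    (h : ((A - B) * (A - B)ᴴ).trace.re ≤ 0) : A = B := by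
  have h0 := (posSemidef_self_mul_conjTranspose (A - B)).trace_nonneg
  rw [Complex.nonneg_iff] at h0
  refine sub_eq_zero.1 (trace_mul_conjTranspose_self_eq_zero_iff.1 ?_)
  exact Complex.ext (le_antisymm h h0.1) h0.2.symm

theorem commute_of_trace_mul_le {n : Type*} [Fintype n] [DecidableEq n] {P Q : Matrix n n ℂ}
    (hP : P.PosSemidef) (hQ : Q.PosSemidef)
    (h : (P * P * (Q * Q)).trace.re ≤ ‖((P * Q) ^ 2).trace‖) : Commute P Q := by
  have hnonneg : 0 ≤ ((P * Q) ^ 2).trace := by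
    have h1 : (P * Q * Pᴴ).PosSemidef := hQ.mul_mul_conjTranspose_same P
    have h2 := trace_mul_nonneg_of_posSemidef h1 hQ
    rwa [hP.isHermitian.eq, mul_assoc (P * Q), ← pow_two] at h2
  have hre : ‖((P * Q) ^ 2).trace‖ = (P * Q * (P * Q)).trace.re := by
    rw [← pow_two]
    exact (congrArg Complex.re (Complex.eq_coe_norm_of_nonneg hnonneg)).symm
  rw [hre] at h
  have h1 : (P * Q * (Q * P)).trace = (P * P * (Q * Q)).trace := by
    rw [← mul_assoc, Matrix.trace_mul_comm]
    simp only [mul_assoc]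
  have h2 : (Q * P * (Q * P)).trace = (P * Q * (P * Q)).trace := by
    rw [mul_assoc, Matrix.trace_mul_comm]
    simp only [mul_assoc]
  refine eq_of_trace_sub_mul_conjTranspose_nonpos ?_
  rw [conjTranspose_sub, conjTranspose_mul, conjTranspose_mul, hP.isHermitian.eq,
    hQ.isHermitian.eq, sub_mul, mul_sub, mul_sub, trace_sub, trace_sub, trace_sub,
    Matrix.trace_mul_comm (Q * P) (P * Q), h1, h2]
  simp only [Complex.sub_re]
  linarith

open Filter Topology in
theorem commute_and_eq_mul_of_log_trace_nonneg {n : Type*} [Fintype n] [DecidableEq n]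
    {ρ U V : Matrix n n ℂ} {x y : n → ℝ} (hρ : ρ.PosSemidef) (hU : Uᴴ * U = 1) (hV : Vᴴ * V = 1)
    (hx : ∀ i, 0 ≤ x i) (hy : ∀ i, 0 ≤ y i)
    (htr : ρ.trace.re = (unitaryDiag U x * unitaryDiag V y).trace.re)
    (hlog : ∀ ε > 0, 0 ≤ (ρ * unitaryDiag U (fun i => Real.log (x i + ε))).trace.re +
      (ρ * unitaryDiag V (fun i => Real.log (y i + ε))).trace.re + vNEntropy ρ) :
    ρ = unitaryDiag U x * unitaryDiag V y ∧ Commute (unitaryDiag U x) (unitaryDiag V y) := by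
  set P : ℝ → Matrix n n ℂ := fun ε => unitaryDiag U (fun i => √(x i + ε)) with hPdef
  set Q : ℝ → Matrix n n ℂ := fun ε => unitaryDiag V (fun i => √(y i + ε)) with hQdef
  have hPc : Continuous P := continuous_unitaryDiag U (by fun_prop)
  have hQc : Continuous Q := continuous_unitaryDiag V (by fun_prop)
  have hexp {W : Matrix n n ℂ} (hW : Wᴴ * W = 1) {z : n → ℝ} (hz : ∀ i, 0 ≤ z i) {ε : ℝ}
      (hε : 0 < ε) : NormedSpace.exp ((2 : ℝ)⁻¹ • unitaryDiag W (fun i => Real.log (z i + ε))) =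
        unitaryDiag W (fun i => √(z i + ε)) := by
    rw [unitaryDiag_smul, exp_unitaryDiag hW]
    congr 1
    ext i
    have hpos : 0 < z i + ε := add_pos_of_nonneg_of_pos (hz i) hε
    rw [← Real.exp_log (Real.sqrt_pos.2 hpos), Real.log_sqrt hpos.le, inv_mul_eq_div]
  have hP0 : P 0 * P 0 = unitaryDiag U x := by
    simp only [hPdef, add_zero]
    rw [unitaryDiag_mul hU]
    simp only [Real.mul_self_sqrt (hx _)]
  have hQ0 : Q 0 * Q 0 = unitaryDiag V y := by
    simp only [hQdef, add_zero]
    rw [unitaryDiag_mul hV]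
    simp only [Real.mul_self_sqrt (hy _)]
  have hPQ : Commute (P 0) (Q 0) := by
    refine commute_of_trace_mul_le (posSemidef_unitaryDiag _ fun _ => Real.sqrt_nonneg _)
      (posSemidef_unitaryDiag _ fun _ => Real.sqrt_nonneg _) ?_
    rw [hP0, hQ0, ← htr]
    have hc : Continuous fun ε => ‖((P ε * Q ε) ^ 2).trace‖ := by fun_prop
    refine ge_of_tendsto (hc.continuousWithinAt (s := Set.Ioi 0)) ?_
    filter_upwards [self_mem_nhdsWithin] with ε hε
    have hA := isHermitian_unitaryDiag U (fun i => Real.log (x i + ε))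
    have hB := isHermitian_unitaryDiag V (fun i => Real.log (y i + ε))
    have h1 := trace_mul_add_vNEntropy_le_exp hρ (hA.add hB)
    have h2 := norm_trace_exp_add_le hA hB
    rw [hexp hU hx hε, hexp hV hy hε] at h2
    have h3 := hlog ε hε
    rw [mul_add, trace_add, Complex.add_re] at h1
    have h4 := (le_abs_self _).trans (Complex.abs_re_le_norm
      (NormedSpace.exp (unitaryDiag U (fun i => Real.log (x i + ε)) +
        unitaryDiag V (fun i => Real.log (y i + ε)))).trace)
    change _ ≤ ‖((unitaryDiag U (fun i => √(x i + ε)) * unitaryDiag V (fun i => √(y i + ε)))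
      ^ 2).trace‖
    linarith
  have hcomm (f g : ℝ → ℝ) :
      Commute (unitaryDiag U (fun i => f (√(x i + 0)))) (unitaryDiag V (fun i => g (√(y i + 0)))) :=
    (commute_unitaryDiag_comp hV (commute_unitaryDiag_comp hU hPQ f).symm g).symm
  have hXY : unitaryDiag U x * unitaryDiag V y = (P 0 * Q 0) * (P 0 * Q 0) := by
    rw [← hP0, ← hQ0, Commute.mul_mul_mul_comm hPQ]
  refine ⟨?_, ?_⟩
  · obtain ⟨W, r, hW, hr, rfl⟩ := exists_unitaryDiag_of_posSemidef hρ
    have hSh : (P 0 * Q 0).IsHermitian :=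
      ((isHermitian_unitaryDiag _ _).commute_iff (isHermitian_unitaryDiag _ _)).1 hPQ
    have hle : (unitaryDiag W r).trace.re ≤
        (unitaryDiag W (fun i => √(r i)) * (P 0 * Q 0)).trace.re := by
      have hc : Continuous fun ε => (unitaryDiag W (fun i => √(r i)) * (P ε * Q ε)).trace.re := by
        fun_prop
      refine ge_of_tendsto (hc.continuousWithinAt (s := Set.Ioi 0)) ?_
      filter_upwards [self_mem_nhdsWithin] with ε hε
      have hA := isHermitian_unitaryDiag U (fun i => Real.log (x i + ε))
      have hB := isHermitian_unitaryDiag V (fun i => Real.log (y i + ε))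
      have hAB : Commute (unitaryDiag U (fun i => Real.log (x i + ε)))
          (unitaryDiag V (fun i => Real.log (y i + ε))) := by
        convert! hcomm (fun t => Real.log (t ^ 2 + ε)) (fun t => Real.log (t ^ 2 + ε)) using 4
        · rw [add_zero, Real.sq_sqrt (hx _)]
        · rw [add_zero, Real.sq_sqrt (hy _)]
      obtain ⟨K, hK, hH⟩ := exists_unitaryDiag_of_isHermitian (hA.add hB)
      set h := (hA.add hB).eigenvalues
      have hexpH : unitaryDiag K (fun i => Real.exp (h i / 2)) = P ε * Q ε := by
        have h1 : NormedSpace.exp ((2 : ℝ)⁻¹ • unitaryDiag K h) =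
            unitaryDiag K (fun i => Real.exp (h i / 2)) := by
          rw [unitaryDiag_smul, exp_unitaryDiag hK]
          simp only [inv_mul_eq_div]
        rw [← h1, ← hH, smul_add, Matrix.exp_add_of_commute _ _
          ((hAB.smul_left _).smul_right _), hexp hU hx hε, hexp hV hy hε]
      have h1 := trace_mul_add_vNEntropy_le hW hK hr h
      rw [hexpH, ← hH, mul_add, trace_add, Complex.add_re] at h1
      have h2 := hlog ε hε
      linarith
    have hsq : unitaryDiag W (fun i => √(r i)) * unitaryDiag W (fun i => √(r i)) =
        unitaryDiag W r := by
      rw [unitaryDiag_mul hW]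
      simp only [Real.mul_self_sqrt (hr _)]
    have hroot : unitaryDiag W (fun i => √(r i)) = P 0 * Q 0 := by
      refine eq_of_trace_sub_mul_conjTranspose_nonpos ?_
      rw [conjTranspose_sub, (isHermitian_unitaryDiag _ _).eq, hSh.eq, sub_mul, mul_sub, mul_sub,
        hsq, ← hXY, trace_sub, trace_sub, trace_sub, Matrix.trace_mul_comm (P 0 * Q 0)]
      simp only [Complex.sub_re]
      linarith
    rw [hXY, ← hroot, hsq]
  · rw [← hP0, ← hQ0]
    exact (Commute.mul_left hPQ hPQ).mul_right (Commute.mul_left hPQ hPQ)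

section tensorExt

open Kronecker

variable {N m c m' c' : Type*}

/-- The extension `M ⊗ 1` of a matrix along a factorization `N ≃ m × c` of the index type. -/
def tensorExt {N m c : Type*} [DecidableEq c] (e : N ≃ m × c) (M : Matrix m m ℂ) : Matrix N N ℂ :=
  (M ⊗ₖ (1 : Matrix c c ℂ)).submatrix e e

/-- The partial trace over the second factor of a factorization `N ≃ m × c` of the index type. -/
def tensorMarg {N m c : Type*} [Fintype c] (e : N ≃ m × c) (M : Matrix N N ℂ) : Matrix m m ℂ :=
  ptrace₂ (M.submatrix e.symm e.symm)

theorem tensorExt_one [DecidableEq N] [DecidableEq m] [DecidableEq c]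
    (e : N ≃ m × c) : tensorExt e 1 = 1 := by
  rw [tensorExt, one_kronecker_one, submatrix_one_equiv]

theorem tensorExt_mul [Fintype N] [Fintype m] [Fintype c] [DecidableEq c]
    (e : N ≃ m × c) (A B : Matrix m m ℂ) :
    tensorExt e (A * B) = tensorExt e A * tensorExt e B := by
  rw [tensorExt, tensorExt, tensorExt, submatrix_mul_equiv, ← mul_kronecker_mul, mul_one]

theorem tensorExt_conjTranspose [DecidableEq c]
    (e : N ≃ m × c) (A : Matrix m m ℂ) :
    tensorExt e Aᴴ = (tensorExt e A)ᴴ := by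
  rw [tensorExt, tensorExt, conjTranspose_submatrix, conjTranspose_kronecker, conjTranspose_one]

theorem tensorExt_unitaryDiag [Fintype N] [DecidableEq N] [Fintype m] [DecidableEq m]
    [Fintype c] [DecidableEq c]
    (e : N ≃ m × c) (U : Matrix m m ℂ) (f : m → ℝ) :
    tensorExt e (unitaryDiag U f) = unitaryDiag (tensorExt e U) (fun p => f (e p).1) := by
  have h : tensorExt e (diagonal fun i => (f i : ℂ)) = diagonal fun p => (f (e p).1 : ℂ) := by
    rw [tensorExt, ← diagonal_one, diagonal_kronecker_diagonal, submatrix_diagonal_equiv]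
    simp [Function.comp_def]
  rw [unitaryDiag, tensorExt_mul, tensorExt_mul, h, tensorExt_conjTranspose, unitaryDiag]

theorem tensorMarg_tensorExt_mul [Fintype N] [Fintype m] [Fintype c] [DecidableEq c]
    (e : N ≃ m × c) (A : Matrix m m ℂ) (M : Matrix N N ℂ) :
    tensorMarg e (tensorExt e A * M) = A * tensorMarg e M := by
  ext i j
  simp only [tensorMarg, ptrace₂, tensorExt, mul_apply, of_apply, submatrix_apply,
    Equiv.apply_symm_apply, kroneckerMap_apply, Finset.mul_sum, ← e.symm.sum_comp (M := ℂ),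
    Fintype.sum_prod_type, one_apply, mul_ite, mul_one, mul_zero, ite_mul, zero_mul,
    Finset.sum_ite_eq, Finset.mem_univ, if_true]
  exact Finset.sum_comm

theorem tensorMarg_mul_tensorExt [Fintype N] [Fintype m] [Fintype c] [DecidableEq c]
    (e : N ≃ m × c) (A : Matrix m m ℂ) (M : Matrix N N ℂ) :
    tensorMarg e (M * tensorExt e A) = tensorMarg e M * A := by
  have hc (B : Matrix N N ℂ) : tensorMarg e Bᴴ = (tensorMarg e B)ᴴ := by
    ext i j
    simp [tensorMarg, ptrace₂]
  have h := tensorMarg_tensorExt_mul e Aᴴ Mᴴ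
  rw [tensorExt_conjTranspose, ← conjTranspose_mul, hc, hc, ← conjTranspose_mul] at h
  exact conjTranspose_injective h

theorem trace_tensorMarg [Fintype N] [Fintype m] [Fintype c]
    (e : N ≃ m × c) (M : Matrix N N ℂ) :
    (tensorMarg e M).trace = M.trace := by
  simp only [Matrix.trace, tensorMarg, ptrace₂, diag_apply, of_apply, submatrix_apply]
  rw [← e.symm.sum_comp, Fintype.sum_prod_type]

theorem posSemidef_tensorMarg [Fintype c]
    (e : N ≃ m × c) {M : Matrix N N ℂ} (hM : M.PosSemidef) :
    (tensorMarg e M).PosSemidef := by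
  have h : tensorMarg e M = ∑ j, M.submatrix (fun i => e.symm (i, j)) (fun i => e.symm (i, j)) := by
    ext i i'
    simp [tensorMarg, ptrace₂, Matrix.sum_apply]
  rw [h]
  exact posSemidef_sum _ fun j _ => hM.submatrix _

theorem tensorMarg_smul [Fintype c]
    (e : N ≃ m × c) (r : ℂ) (M : Matrix N N ℂ) :
    tensorMarg e (r • M) = r • tensorMarg e M := by
  ext i j
  simp [tensorMarg, ptrace₂, Finset.mul_sum]

theorem neg_vNEntropy_le_trace_mul_log [Fintype N] [DecidableEq N] [Fintype m]
    [DecidableEq m] [Fintype c] [DecidableEq c]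
    (e : N ≃ m × c) {ρ : Matrix N N ℂ} {U : Matrix m m ℂ}
    {f : m → ℝ} (hU : Uᴴ * U = 1) (hf : ∀ i, 0 ≤ f i) (h : tensorMarg e ρ = unitaryDiag U f)
    {ε : ℝ} (hε : 0 < ε) :
    -vNEntropy (tensorMarg e ρ) ≤
      (ρ * unitaryDiag (tensorExt e U) (fun p => Real.log (f (e p).1 + ε))).trace.re := by
  rw [← tensorExt_unitaryDiag e U (fun i => Real.log (f i + ε)), ← trace_tensorMarg e,
    tensorMarg_mul_tensorExt, h, unitaryDiag_mul hU, trace_unitaryDiag hU,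
    vNEntropy_unitaryDiag hU, neg_neg, Complex.ofReal_re]
  refine Finset.sum_le_sum fun i _ => ?_
  rcases (hf i).eq_or_lt with h0 | h0
  · simp [← h0]
  · exact mul_le_mul_of_nonneg_left (Real.log_le_log h0 (by linarith)) h0.le

/-- A positive semidefinite matrix whose entropy is the sum of the entropies of two of its
marginals, correctly normalized, is the product of the extensions of these marginals. -/
theorem eq_mul_and_commute_of_vNEntropy_add [Fintype N] [DecidableEq N]
    [Fintype m] [DecidableEq m] [Fintype c] [DecidableEq c]
    [Fintype m'] [DecidableEq m'] [Fintype c'] [DecidableEq c']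
    (e : N ≃ m × c) (e' : N ≃ m' × c') {ρ : Matrix N N ℂ}
    (hρ : ρ.PosSemidef)
    (htr : (tensorExt e (tensorMarg e ρ) * tensorExt e' (tensorMarg e' ρ)).trace = ρ.trace)
    (hS : vNEntropy (tensorMarg e ρ) + vNEntropy (tensorMarg e' ρ) = vNEntropy ρ) :
    ρ = tensorExt e (tensorMarg e ρ) * tensorExt e' (tensorMarg e' ρ) ∧
      Commute (tensorExt e (tensorMarg e ρ)) (tensorExt e' (tensorMarg e' ρ)) := by
  obtain ⟨U, x, hU, hx, hUx⟩ := exists_unitaryDiag_of_posSemidef (posSemidef_tensorMarg e hρ)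
  obtain ⟨V, y, hV, hy, hVy⟩ := exists_unitaryDiag_of_posSemidef (posSemidef_tensorMarg e' hρ)
  have hlog (ε : ℝ) (hε : 0 < ε) :
      0 ≤ (ρ * unitaryDiag (tensorExt e U) (fun p => Real.log (x (e p).1 + ε))).trace.re +
        (ρ * unitaryDiag (tensorExt e' V) (fun p => Real.log (y (e' p).1 + ε))).trace.re +
        vNEntropy ρ := by
    have h1 := neg_vNEntropy_le_trace_mul_log e hU hx hUx hε
    have h2 := neg_vNEntropy_le_trace_mul_log e' hV hy hVy hε
    linarith
  rw [hUx, hVy, tensorExt_unitaryDiag, tensorExt_unitaryDiag] at htr ⊢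
  exact commute_and_eq_mul_of_log_trace_nonneg hρ
    (by rw [← tensorExt_conjTranspose, ← tensorExt_mul, hU, tensorExt_one])
    (by rw [← tensorExt_conjTranspose, ← tensorExt_mul, hV, tensorExt_one])
    (fun p => hx _) (fun p => hy _) (by rw [htr]) hlog

end tensorExt

theorem vNEntropy_smul {n : Type*} [Fintype n] [DecidableEq n] {M : Matrix n n ℂ}
    (hM : M.PosSemidef) {r : ℝ} (hr : 0 < r) :
    vNEntropy ((r : ℂ) • M) = r * vNEntropy M - r * Real.log r * M.trace.re := by
  obtain ⟨U, f, hU, hf, rfl⟩ := exists_unitaryDiag_of_posSemidef hM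
  rw [Complex.coe_smul, unitaryDiag_smul, vNEntropy_unitaryDiag hU, vNEntropy_unitaryDiag hU,
    trace_unitaryDiag hU, Complex.ofReal_re, mul_neg, Finset.mul_sum, Finset.mul_sum,
    ← Finset.sum_neg_distrib, ← Finset.sum_neg_distrib, ← Finset.sum_sub_distrib]
  refine Finset.sum_congr rfl fun i _ => ?_
  rcases (hf i).eq_or_lt with h0 | h0
  · simp [← h0]
  · rw [Real.log_mul hr.ne' h0.ne']
    ring

theorem vNEntropy_one {n : Type*} [Fintype n] [DecidableEq n] :
    vNEntropy (1 : Matrix n n ℂ) = 0 := by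
  have h : (1 : Matrix n n ℂ) = unitaryDiag 1 (fun _ => 1) := by simp [unitaryDiag]
  rw [h, vNEntropy_unitaryDiag (by simp)]
  simp

section iteratedExpectation

variable {ι R : Type*} [Ring R] {T : ι → R → R} {X : ι → R} {ρ : R}

theorem eq_prod_mul_foldr (hT : ∀ i j, i ≠ j → ∀ M, T i (X j * M) = X j * T i M)
    (hρ : ∀ i, ρ = X i * T i ρ) {l : List ι} (hl : l.Nodup) :
    ρ = (l.map X).prod * l.foldr T ρ := by
  have hprod (i : ι) (l : List ι) (hi : i ∉ l) (M : R) :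
      T i ((l.map X).prod * M) = (l.map X).prod * T i M := by
    induction l with
    | nil => simp
    | cons j l ih =>
      rw [List.mem_cons, not_or] at hi
      rw [List.map_cons, List.prod_cons, mul_assoc, hT i j hi.1, ih hi.2, mul_assoc]
  induction l with
  | nil => simp
  | cons i l ih =>
    rw [List.nodup_cons] at hl
    rw [List.map_cons, List.prod_cons, List.foldr_cons, mul_assoc, ← hprod i l hl.1, ← ih hl.2]
    exact hρ i

theorem foldr_mul_prod (hT : ∀ i j, i ≠ j → ∀ M, T i (X j * M) = X j * T i M)
    (h1 : ∀ i, T i (X i) = 1) {l : List ι} (hl : l.Nodup) {Y : R}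
    (hY : ∀ i ∈ l, ∀ M, T i (Y * M) = Y * T i M) :
    l.foldr T (Y * (l.map X).prod) = Y := by
  induction l generalizing Y with
  | nil => simp
  | cons i l ih =>
    rw [List.nodup_cons] at hl
    rw [List.map_cons, List.prod_cons, List.foldr_cons, ← mul_assoc, ih hl.2, hY i (by simp), h1,
      mul_one]
    intro j hj M
    have hji : j ≠ i := fun h => hl.1 (h ▸ hj)
    rw [mul_assoc, hY j (by simp [hj]), hT j i hji, mul_assoc]

theorem commute_foldr (hT : ∀ i j, i ≠ j → ∀ M, T i (X j * M) = X j * T i M)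
    (hT' : ∀ i j, i ≠ j → ∀ M, T i (M * X j) = T i M * X j) {i : ι} {M : R}
    (h : Commute (X i) M) {l : List ι} (hi : i ∉ l) : Commute (X i) (l.foldr T M) := by
  induction l with
  | nil => exact h
  | cons j l ih =>
    rw [List.mem_cons, not_or] at hi
    have h1 := ih hi.2
    rw [List.foldr_cons, Commute, SemiconjBy, ← hT j i (Ne.symm hi.1), h1.eq,
      hT' j i (Ne.symm hi.1)]

theorem commute_of_eq_mul_expectation [Fintype ι] [DecidableEq ι]
    (hT : ∀ i j, i ≠ j → ∀ M, T i (X j * M) = X j * T i M)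
    (hT' : ∀ i j, i ≠ j → ∀ M, T i (M * X j) = T i M * X j) (h1 : ∀ i, T i (X i) = 1)
    (hρ : ∀ i, ρ = X i * T i ρ) (hcomm : ∀ i, Commute (X i) (T i ρ))
    (hfull : ∀ l : List ι, l.Nodup → (∀ i, i ∈ l) → l.foldr T ρ = 1) (i j : ι) :
    Commute (X i) (X j) := by
  rcases eq_or_ne i j with rfl | hij
  · rfl
  set l := ((Finset.univ.erase i).erase j).toList
  have hil : i ∉ l := by simp [l]
  have hjl : j ∉ l ++ [i] := by simp [l, hij.symm]
  have hl : (l ++ [i]).Nodup := List.nodup_append.2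
    ⟨Finset.nodup_toList _, by simp, by rintro x hx y hy rfl; simp_all⟩
  have hl' : (j :: (l ++ [i])).Nodup := List.nodup_cons.2 ⟨hjl, hl⟩
  have hmem (x : ι) : x ∈ j :: (l ++ [i]) := by
    by_cases hxi : x = i <;> by_cases hxj : x = j <;> simp [l, hxi, hxj]
  have hprod := eq_prod_mul_foldr hT hρ hl'
  rw [hfull _ hl' hmem, mul_one, List.map_cons, List.prod_cons] at hprod
  have hXj : l.foldr T (T i ρ) = X j := by
    have h2 := foldr_mul_prod hT h1 hl (Y := X j)
      fun x hx => hT x j fun h => hjl (h ▸ hx)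
    rw [← hprod, List.foldr_append] at h2
    exact h2
  exact hXj ▸ commute_foldr hT hT' (hcomm i) hil

end iteratedExpectation
set_option linter.unusedSectionVars false

theorem insertAt_self (i : Fin k) (x : β i) (g : ∀ j : {j : Fin k // j ≠ i}, β j.1) :
    insertAt i x g i = x := by
  simp [insertAt]

theorem insertAt_of_ne (i : Fin k) (x : β i) (g : ∀ j : {j : Fin k // j ≠ i}, β j.1)
    {j : Fin k} (h : j ≠ i) : insertAt i x g j = g ⟨j, h⟩ := by
  simp [insertAt, h]

theorem insertAt_restrict (i : Fin k) (x : β i) (v : ∀ j, β j) :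
    insertAt i x (fun j : {j : Fin k // j ≠ i} => v j.1) = Function.update v i x := by
  ext j
  by_cases h : j = i
  · subst h
    rw [insertAt_self, Function.update_self]
  · rw [insertAt_of_ne _ _ _ h, Function.update_of_ne h]

/-- The factorization of a tuple of outputs singling out output `i`. -/
def outSplit (i : Fin k) : (∀ j, β j) ≃ β i × (∀ j : {j : Fin k // j ≠ i}, β j.1) where
  toFun v := (v i, fun j => v j.1)
  invFun q := insertAt i q.1 q.2
  left_inv v := by simp [insertAt_restrict]
  right_inv q := by
    refine Prod.ext (insertAt_self _ _ _) ?_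
    funext j
    exact insertAt_of_ne _ _ _ j.2

/-- The factorization singling out output `i`, together with the input, from the other outputs. -/
def outEquiv (a : Type*) (i : Fin k) :
    (∀ j, β j) × a ≃ (β i × a) × (∀ j : {j : Fin k // j ≠ i}, β j.1) where
  toFun p := ((p.1 i, p.2), fun j => p.1 j.1)
  invFun q := (insertAt i q.1.1 q.2, q.1.2)
  left_inv p := by simp [insertAt_restrict]
  right_inv q := by
    refine Prod.ext (Prod.ext (insertAt_self _ _ _) rfl) ?_
    funext j
    exact insertAt_of_ne _ _ _ j.2

/-- The factorization singling out output `i` from the other outputs and the input. -/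
def restEquiv (a : Type*) (i : Fin k) :
    (∀ j, β j) × a ≃ ((∀ j : {j : Fin k // j ≠ i}, β j.1) × a) × β i where
  toFun p := ((fun j => p.1 j.1, p.2), p.1 i)
  invFun q := (insertAt i q.2 q.1.1, q.1.2)
  left_inv p := by simp [insertAt_restrict]
  right_inv q := by
    refine Prod.ext (Prod.ext ?_ rfl) (insertAt_self _ _ _)
    funext j
    exact insertAt_of_ne _ _ _ j.2

theorem tensorMarg_outEquiv (i : Fin k) (ρ : Matrix ((∀ j, β j) × a) ((∀ j, β j) × a) ℂ) :
    tensorMarg (outEquiv a i) ρ = margOut i ρ := rfl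

theorem tensorMarg_restEquiv (i : Fin k) (ρ : Matrix ((∀ j, β j) × a) ((∀ j, β j) × a) ℂ) :
    tensorMarg (restEquiv a i) ρ = margRest i ρ := rfl

theorem tensorExt_outEquiv (i : Fin k) (M : Matrix (β i × a) (β i × a) ℂ) :
    tensorExt (outEquiv a i) M = extOut i M := by
  ext p q
  simp only [tensorExt, submatrix_apply, kroneckerMap_apply, extOut, of_apply, one_apply, outEquiv,
    Equiv.coe_fn_mk, Finset.prod_ite_zero, Finset.prod_const_one]
  congr 2
  simp [funext_iff]

/-- The partial trace over output `i`, extended back by the identity on output `i`. -/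
def traceOut (i : Fin k) (M : Matrix ((∀ j, β j) × a) ((∀ j, β j) × a) ℂ) :
    Matrix ((∀ j, β j) × a) ((∀ j, β j) × a) ℂ :=
  tensorExt (restEquiv a i) (tensorMarg (restEquiv a i) M)

theorem traceOut_apply (i : Fin k) (M : Matrix ((∀ j, β j) × a) ((∀ j, β j) × a) ℂ)
    (p q : (∀ j, β j) × a) :
    traceOut i M p q = (∑ b, M (Function.update p.1 i b, p.2) (Function.update q.1 i b, q.2)) *
      if p.1 i = q.1 i then 1 else 0 := by
  simp only [← insertAt_restrict]
  rfl

theorem extOut_eq_tensorExt_restEquiv {i j : Fin k} (h : i ≠ j)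
    (K : Matrix (β j × a) (β j × a) ℂ) :
    extOut j K = tensorExt (restEquiv a i) (Matrix.of fun p q =>
      K (p.1 ⟨j, h.symm⟩, p.2) (q.1 ⟨j, h.symm⟩, q.2) *
        ∏ l : {l : Fin k // l ≠ i}, if l.1 = j ∨ p.1 l = q.1 l then 1 else 0) := by
  ext p q
  simp only [tensorExt, submatrix_apply, kroneckerMap_apply, extOut, of_apply, one_apply, restEquiv,
    Equiv.coe_fn_mk, Finset.prod_ite_zero, Finset.prod_const_one, mul_ite, mul_one, mul_zero,
    ← ite_and]
  congr 2
  simp only [Finset.mem_erase, Finset.mem_univ, and_true, true_implies, Subtype.forall, eq_iff_iff]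
  constructor
  · exact fun H => ⟨H i h, fun l _ => or_iff_not_imp_left.2 fun hl => H l hl⟩
  · rintro ⟨H1, H2⟩ l hl
    by_cases hli : l = i
    · exact hli ▸ H1
    · exact (H2 l hli).resolve_left hl

theorem traceOut_extOut_mul {i j : Fin k} (h : i ≠ j) (K : Matrix (β j × a) (β j × a) ℂ)
    (M : Matrix ((∀ j, β j) × a) ((∀ j, β j) × a) ℂ) :
    traceOut i (extOut j K * M) = extOut j K * traceOut i M := by
  rw [extOut_eq_tensorExt_restEquiv h, traceOut, traceOut, tensorMarg_tensorExt_mul, tensorExt_mul]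

theorem traceOut_mul_extOut {i j : Fin k} (h : i ≠ j) (K : Matrix (β j × a) (β j × a) ℂ)
    (M : Matrix ((∀ j, β j) × a) ((∀ j, β j) × a) ℂ) :
    traceOut i (M * extOut j K) = traceOut i M * extOut j K := by
  rw [extOut_eq_tensorExt_restEquiv h, traceOut, traceOut, tensorMarg_mul_tensorExt, tensorExt_mul]

theorem ptrace₁_margOut (i : Fin k) (ρ : Matrix ((∀ j, β j) × a) ((∀ j, β j) × a) ℂ) :
    ptrace₁ (margOut i ρ) = ptrace₁ ρ := by
  ext x x'
  simp only [ptrace₁, margOut, of_apply]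
  rw [← (outSplit i).symm.sum_comp, Fintype.sum_prod_type]
  rfl

theorem tensorMarg_restEquiv_extOut (i : Fin k) {K : Matrix (β i × a) (β i × a) ℂ}
    (hK : ptrace₁ K = 1) : tensorMarg (restEquiv a i) (extOut i K) = 1 := by
  ext p q
  have hpq : ∀ b : β i, extOut i K (insertAt i b p.1, p.2) (insertAt i b q.1, q.2) =
      K (b, p.2) (b, q.2) * if p.1 = q.1 then 1 else 0 := by
    intro b
    rw [← tensorExt_outEquiv]
    change tensorExt (outEquiv a i) K ((outEquiv a i).symm ((b, p.2), p.1))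
      ((outEquiv a i).symm ((b, q.2), q.1)) = _
    simp [tensorExt, one_apply]
  change ∑ b, extOut i K (insertAt i b p.1, p.2) (insertAt i b q.1, q.2) = _
  simp only [hpq]
  have h := congrFun (congrFun hK p.2) q.2
  simp only [ptrace₁, of_apply] at h
  rw [← Finset.sum_mul, h]
  by_cases h1 : p.1 = q.1 <;> by_cases h2 : p.2 = q.2 <;> simp [one_apply, Prod.ext_iff, h1, h2]

theorem traceOut_extOut (i : Fin k) {K : Matrix (β i × a) (β i × a) ℂ} (hK : ptrace₁ K = 1) :
    traceOut i (extOut i K) = 1 := by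
  rw [traceOut, tensorMarg_restEquiv_extOut i hK, tensorExt_one]

/-- `M` acts as the identity on output `i`. -/
def IsTrivialAt (i : Fin k) (M : Matrix ((∀ j, β j) × a) ((∀ j, β j) × a) ℂ) : Prop :=
  ∀ b p q, M p q = M (Function.update p.1 i b, p.2) (Function.update q.1 i b, q.2) *
    if p.1 i = q.1 i then 1 else 0

theorem isTrivialAt_traceOut (i : Fin k) (M : Matrix ((∀ j, β j) × a) ((∀ j, β j) × a) ℂ) :
    IsTrivialAt i (traceOut i M) := by
  intro b p q
  simp [traceOut_apply]

theorem IsTrivialAt.traceOut {i : Fin k} {M : Matrix ((∀ j, β j) × a) ((∀ j, β j) × a) ℂ}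
    (hM : IsTrivialAt i M) (j : Fin k) : IsTrivialAt i (traceOut j M) := by
  rcases eq_or_ne i j with rfl | hij
  · exact isTrivialAt_traceOut _ _
  · intro b p q
    rw [traceOut_apply, traceOut_apply, Finset.sum_congr rfl fun c _ => hM b _ _]
    simp only [Function.update_of_ne hij, Function.update_of_ne hij.symm, ← Finset.sum_mul,
      Function.update_comm hij]
    exact mul_right_comm _ _ _

theorem isTrivialAt_foldr_traceOut {i : Fin k} {l : List (Fin k)} (hi : i ∈ l)
    (M : Matrix ((∀ j, β j) × a) ((∀ j, β j) × a) ℂ) : IsTrivialAt i (l.foldr traceOut M) := by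
  induction l with
  | nil => simp at hi
  | cons j l ih =>
    rw [List.foldr_cons]
    rcases List.mem_cons.1 hi with rfl | h
    · exact isTrivialAt_traceOut _ _
    · exact (ih h).traceOut j

theorem apply_eq_of_isTrivialAt {M : Matrix ((∀ j, β j) × a) ((∀ j, β j) × a) ℂ}
    (hM : ∀ i, IsTrivialAt i M) (v : ∀ j, β j) (p q : (∀ j, β j) × a) :
    M p q = M (v, p.2) (v, q.2) * if p.1 = q.1 then 1 else 0 := by
  have h (s : Finset (Fin k)) : M p q = M (s.piecewise v p.1, p.2) (s.piecewise v q.1, q.2) *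
      if ∀ j ∈ s, p.1 j = q.1 j then 1 else 0 := by
    induction s using Finset.induction_on with
    | empty => simp
    | insert j s hj ih =>
      rw [ih, hM j (v j) (_, _), Finset.piecewise_insert, Finset.piecewise_insert, mul_assoc]
      congr 1
      simp only [Finset.mem_insert, forall_eq_or_imp, ite_and, hj, not_false_eq_true,
        Finset.piecewise_eq_of_notMem]
      split_ifs <;> simp
  simpa [funext_iff] using h Finset.univ

theorem ptrace₁_traceOut (i : Fin k) (M : Matrix ((∀ j, β j) × a) ((∀ j, β j) × a) ℂ) :
    ptrace₁ (traceOut i M) = (Fintype.card (β i) : ℂ) • ptrace₁ M := by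
  ext x x'
  simp only [ptrace₁, of_apply, traceOut_apply, if_true, mul_one, Matrix.smul_apply, smul_eq_mul]
  rw [← (outSplit i).symm.sum_comp, ← (outSplit i).symm.sum_comp (M := ℂ), Fintype.sum_prod_type]
  have h (b c : β i) (g : ∀ j : {j : Fin k // j ≠ i}, β j.1) :
      Function.update ((outSplit i).symm (b, g)) i c = (outSplit i).symm (c, g) := by
    rw [← insertAt_restrict]
    exact congrArg (insertAt i c) (funext fun j => insertAt_of_ne _ _ _ j.2)
  simp only [h, Finset.sum_const, Finset.card_univ, nsmul_eq_mul]
  rw [Finset.sum_comm, Fintype.sum_prod_type]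

theorem ptrace₁_foldr_traceOut (l : List (Fin k))
    (M : Matrix ((∀ j, β j) × a) ((∀ j, β j) × a) ℂ) :
    ptrace₁ (l.foldr traceOut M) =
      (l.map fun i => (Fintype.card (β i) : ℂ)).prod • ptrace₁ M := by
  induction l with
  | nil => simp
  | cons i l ih =>
    rw [List.foldr_cons, ptrace₁_traceOut, ih, List.map_cons, List.prod_cons, mul_smul]

theorem foldr_traceOut_eq_one {M : Matrix ((∀ j, β j) × a) ((∀ j, β j) × a) ℂ}
    (hM : ptrace₁ M = 1) {l : List (Fin k)} (hl : l.Nodup) (h : ∀ i, i ∈ l) :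
    l.foldr traceOut M = 1 := by
  have hZ := apply_eq_of_isTrivialAt fun i => isTrivialAt_foldr_traceOut (h i) M
  obtain ⟨v⟩ : Nonempty (∀ j, β j) := inferInstance
  have hcard : (l.map fun i => (Fintype.card (β i) : ℂ)).prod = Fintype.card (∀ j, β j) := by
    rw [← List.prod_toFinset _ hl, Fintype.card_pi, Nat.cast_prod]
    congr
    ext i
    simp [h]
  have h1 (x x' : a) : l.foldr traceOut M (v, x) (v, x') = (1 : Matrix a a ℂ) x x' := by
    have hp := congrFun (congrFun (ptrace₁_foldr_traceOut l M) x) x'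
    rw [hM, hcard] at hp
    simp only [ptrace₁, of_apply, Matrix.smul_apply, smul_eq_mul] at hp
    rw [Finset.sum_congr rfl fun w _ => hZ v (w, x) (w, x')] at hp
    have h0 : (Fintype.card (∀ j, β j) : ℂ) ≠ 0 := Nat.cast_ne_zero.2 Fintype.card_ne_zero
    refine mul_left_cancel₀ h0 ?_
    simpa only [if_true, mul_one, Finset.sum_const, Finset.card_univ, nsmul_eq_mul] using hp
  ext p q
  rw [hZ v p q, h1]
  by_cases h2 : p.1 = q.1 <;> by_cases h3 : p.2 = q.2 <;> simp [one_apply, Prod.ext_iff, h2, h3]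

theorem trace_ptrace₁ {b c : Type*} [Fintype b] [Fintype c] (M : Matrix (b × c) (b × c) ℂ) :
    (ptrace₁ M).trace = M.trace := by
  simp only [Matrix.trace, ptrace₁, diag_apply, of_apply, Fintype.sum_prod_type]
  exact Finset.sum_comm

theorem trace_extOut_mul_tensorExt_margRest (i : Fin k)
    {ρ : Matrix ((∀ j, β j) × a) ((∀ j, β j) × a) ℂ} (hρ : ptrace₁ ρ = 1) :
    (extOut i (margOut i ρ) * tensorExt (restEquiv a i) (margRest i ρ)).trace = ρ.trace := by
  rw [← trace_tensorMarg (restEquiv a i), tensorMarg_mul_tensorExt,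
    tensorMarg_restEquiv_extOut i ((ptrace₁_margOut i ρ).trans hρ), one_mul,
    ← tensorMarg_restEquiv, trace_tensorMarg]

theorem vNEntropy_margOut_add_margRest {i : Fin k}
    {ρ : Matrix ((∀ j, β j) × a) ((∀ j, β j) × a) ℂ} (hρ : ρ.PosSemidef) (h1 : ptrace₁ ρ = 1)
    (h : qcmiOut i ((1 / (Fintype.card a : ℂ)) • ρ) = 0) :
    vNEntropy (margOut i ρ) + vNEntropy (margRest i ρ) = vNEntropy ρ := by
  have hr : 0 < 1 / (Fintype.card a : ℝ) := by positivity
  have hc : 1 / (Fintype.card a : ℂ) = ((1 / (Fintype.card a : ℝ) : ℝ) : ℂ) := by push_cast; rfl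
  have hp (r : ℂ) : ptrace₁ (r • ρ) = r • ptrace₁ ρ := by
    ext x x'
    simp [ptrace₁, Finset.mul_sum]
  rw [qcmiOut, hc] at h
  generalize 1 / (Fintype.card a : ℝ) = r at hr h
  rw [← tensorMarg_outEquiv, ← tensorMarg_restEquiv, tensorMarg_smul, tensorMarg_smul, hp, h1,
    vNEntropy_smul (posSemidef_tensorMarg _ hρ) hr, vNEntropy_smul (posSemidef_tensorMarg _ hρ) hr,
    vNEntropy_smul hρ hr, vNEntropy_smul PosSemidef.one hr, vNEntropy_one, trace_tensorMarg,
    trace_tensorMarg, ← h1, trace_ptrace₁] at h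
  rw [← tensorMarg_outEquiv, ← tensorMarg_restEquiv, ← mul_right_inj' hr.ne']
  linarith

theorem eq_extOut_mul_traceOut_and_commute {i : Fin k}
    {ρ : Matrix ((∀ j, β j) × a) ((∀ j, β j) × a) ℂ} (hρ : ρ.PosSemidef) (h1 : ptrace₁ ρ = 1)
    (h : qcmiOut i ((1 / (Fintype.card a : ℂ)) • ρ) = 0) :
    ρ = extOut i (margOut i ρ) * traceOut i ρ ∧
      Commute (extOut i (margOut i ρ)) (traceOut i ρ) := by
  rw [← tensorExt_outEquiv]
  refine eq_mul_and_commute_of_vNEntropy_add (outEquiv a i) (restEquiv a i) hρ ?_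
    (vNEntropy_margOut_add_margRest hρ h1 h)
  rw [tensorExt_outEquiv]
  exact trace_extOut_mul_tensorExt_margRest i h1

/-- Theorem 4, 3 ⇒ 2: if each `I(B_i : B̄_i | A)` vanishes on the normalized channel
operator, then the channel operator equals the ordered product of its extended marginals,
and the extended marginals pairwise commute. -/
theorem cmi_zero_implies_product (ρ : Matrix ((∀ j, β j) × a) ((∀ j, β j) × a) ℂ)
    (hρ : ρ.PosSemidef ∧ ptrace₁ ρ = 1)
    (hcmi : ∀ i : Fin k, qcmiOut i ((1 / (Fintype.card a : ℂ)) • ρ) = 0) :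
    ρ = (List.ofFn fun i => extOut i (margOut i ρ)).prod ∧
      ∀ i j : Fin k, Commute (extOut i (margOut i ρ)) (extOut j (margOut j ρ)) := by
  have hT (i j : Fin k) (h : i ≠ j) (M : Matrix ((∀ j, β j) × a) ((∀ j, β j) × a) ℂ) :=
    traceOut_extOut_mul h (margOut j ρ) M
  have hT' (i j : Fin k) (h : i ≠ j) (M : Matrix ((∀ j, β j) × a) ((∀ j, β j) × a) ℂ) :=
    traceOut_mul_extOut h (margOut j ρ) M
  have hprod (i : Fin k) := eq_extOut_mul_traceOut_and_commute hρ.1 hρ.2 (hcmi i)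
  have hfull (l : List (Fin k)) (hl : l.Nodup) (h : ∀ i, i ∈ l) : l.foldr traceOut ρ = 1 :=
    foldr_traceOut_eq_one hρ.2 hl h
  refine ⟨?_, commute_of_eq_mul_expectation hT hT'
    (fun i => traceOut_extOut i ((ptrace₁_margOut i ρ).trans hρ.2))
    (fun i => (hprod i).1) (fun i => (hprod i).2) hfull⟩
  have h := eq_prod_mul_foldr hT (fun i => (hprod i).1) (List.nodup_finRange k)
  rwa [hfull _ (List.nodup_finRange k) List.mem_finRange, mul_one, ← List.ofFn_eq_map] at h

end
end
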